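/- arXiv:2106.09195 — 2 statements merged into one kernel-verified Lean document; each statement's English description precedes it below -/
import Mathlib

section
/- Let A_i (for i a nonempty subset of {0,1,2}) be abelian groups together with homomorphisms p_{i,j} : A_i → A_j for every strict inclusion i ⊊ j, compatible with composition (p_{j,k} ∘ p_{i,j} = p_{i,k} whenever i ⊊ j ⊊ k). Assume that p_{{0,2},{0,1,2}} : A_{{0,2}} → A_{{0,1,2}} is an isomorphism. Then the homomorphism Φ : ∏_{i⊊j} A_j → ∏_{i⊊j⊊k} A_k, defined on the products over strict chains of nonempty subsets of {0,1,2} by (Φb)_{(i,j,k)} = b_{(j,k)} − b_{(i,k)} + p_{j,k}(b_{(i,j)}), is surjective. Consequently the second cohomology of the associated cosimplicial-replacement cochain complex (the higher limit lim² of the diagram) vanishes. -/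
/-- The poset `𝒮(2)` of nonempty subsets of `{0,1,2}`. -/
abbrev S2 := {s : Finset (Fin 3) // s.Nonempty}

/-- A strict chain of length three in `𝒮(2)` consists of a vertex, an edge containing it, and the
full set. -/
lemma S2.strict_chain_cases (i j k : S2) (hij : i.1 ⊂ j.1) (hjk : j.1 ⊂ k.1) :
    k = ⟨Finset.univ, by decide⟩ ∧
      ((i = ⟨{0}, by decide⟩ ∧ j = ⟨{0, 1}, by decide⟩) ∨
        (i = ⟨{1}, by decide⟩ ∧ j = ⟨{0, 1}, by decide⟩) ∨
        (i = ⟨{1}, by decide⟩ ∧ j = ⟨{1, 2}, by decide⟩) ∨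
        (i = ⟨{2}, by decide⟩ ∧ j = ⟨{1, 2}, by decide⟩) ∨
        (i = ⟨{2}, by decide⟩ ∧ j = ⟨{0, 2}, by decide⟩) ∨
        (i = ⟨{0}, by decide⟩ ∧ j = ⟨{0, 2}, by decide⟩)) := by
  obtain ⟨i, hi⟩ := i
  obtain ⟨j, hj⟩ := j
  obtain ⟨k, hk⟩ := k
  simp only [Subtype.mk.injEq] at *
  have hk' : k = Finset.univ := by
    revert i j k
    decide
  subst hk'
  refine ⟨rfl, ?_⟩
  revert i j
  decide

/-- Given a diagram of abelian groups `A` on the poset of nonempty subsets of `{0,1,2}`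
(with functorial maps `p` along strict inclusions) such that the map
`A_{{0,2}} → A_{{0,1,2}}` is an isomorphism, the alternating-sum map `Φ` from the
product over strict chains of length two to the product over strict chains of length
three (the degree-1-to-degree-2 differential of the cosimplicial replacement) is
surjective; consequently `lim²` of the diagram vanishes. -/
theorem surjective_cosimplicial_differential
    (A : S2 → Type*) [∀ i, AddCommGroup (A i)]
    (p : ∀ i j : S2, i.1 ⊂ j.1 → (A i →+ A j))
    (hcomp : ∀ (i j k : S2) (hij : i.1 ⊂ j.1) (hjk : j.1 ⊂ k.1),
      (p j k hjk).comp (p i j hij) = p i k (hij.trans hjk))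
    (hiso : Function.Bijective
      (p ⟨{0, 2}, by decide⟩ ⟨Finset.univ, by decide⟩ (by decide))) :
    Function.Surjective
      (fun (b : ∀ c : {c : S2 × S2 // c.1.1 ⊂ c.2.1}, A c.1.2) =>
        (fun (t : {t : S2 × S2 × S2 // t.1.1 ⊂ t.2.1.1 ∧ t.2.1.1 ⊂ t.2.2.1}) =>
          b ⟨(t.1.2.1, t.1.2.2), t.2.2⟩ - b ⟨(t.1.1, t.1.2.2), t.2.1.trans t.2.2⟩
            + p t.1.2.1 t.1.2.2 t.2.2 (b ⟨(t.1.1, t.1.2.1), t.2.1⟩))) := by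
  -- The six triangles form a hexagon in the unknowns with target the full set. Five of them are
  -- solved successively around the hexagon, and the last one by inverting the isomorphism.
  intro c
  let top : S2 := ⟨Finset.univ, by decide⟩
  let v₀ : S2 := ⟨{0}, by decide⟩
  let v₁ : S2 := ⟨{1}, by decide⟩
  let v₂ : S2 := ⟨{2}, by decide⟩
  let e₀₁ : S2 := ⟨{0, 1}, by decide⟩
  let e₁₂ : S2 := ⟨{1, 2}, by decide⟩
  let e₀₂ : S2 := ⟨{0, 2}, by decide⟩
  let x₀₁ : A top := c ⟨(v₀, e₀₁, top), by decide⟩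
  let y₁ : A top := x₀₁ - c ⟨(v₁, e₀₁, top), by decide⟩
  let x₁₂ : A top := y₁ + c ⟨(v₁, e₁₂, top), by decide⟩
  let y₂ : A top := x₁₂ - c ⟨(v₂, e₁₂, top), by decide⟩
  let x₀₂ : A top := y₂ + c ⟨(v₂, e₀₂, top), by decide⟩
  obtain ⟨z, hz⟩ := hiso.surjective (c ⟨(v₀, e₀₂, top), by decide⟩ - x₀₂)
  let b : ∀ q : {q : S2 × S2 // q.1.1 ⊂ q.2.1}, A q.1.2 :=
    Function.update (Function.update (Function.update (Function.update (Function.update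
      (Function.update 0 ⟨(e₀₁, top), by decide⟩ x₀₁) ⟨(v₁, top), by decide⟩ y₁)
      ⟨(e₁₂, top), by decide⟩ x₁₂) ⟨(v₂, top), by decide⟩ y₂)
      ⟨(e₀₂, top), by decide⟩ x₀₂) ⟨(v₀, e₀₂), by decide⟩ z
  have hx₀₁ : b ⟨(e₀₁, top), by decide⟩ = x₀₁ := rfl
  have hy₁ : b ⟨(v₁, top), by decide⟩ = y₁ := rfl
  have hx₁₂ : b ⟨(e₁₂, top), by decide⟩ = x₁₂ := rfl
  have hy₂ : b ⟨(v₂, top), by decide⟩ = y₂ := rfl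
  have hx₀₂ : b ⟨(e₀₂, top), by decide⟩ = x₀₂ := rfl
  have hy₀ : b ⟨(v₀, top), by decide⟩ = 0 := rfl
  have hz₀ : b ⟨(v₀, e₀₂), by decide⟩ = z := rfl
  have h₀₁ : b ⟨(v₀, e₀₁), by decide⟩ = 0 := rfl
  have h₁₁ : b ⟨(v₁, e₀₁), by decide⟩ = 0 := rfl
  have h₁₂ : b ⟨(v₁, e₁₂), by decide⟩ = 0 := rfl
  have h₂₁ : b ⟨(v₂, e₁₂), by decide⟩ = 0 := rfl
  have h₂₂ : b ⟨(v₂, e₀₂), by decide⟩ = 0 := rfl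
  refine ⟨b, ?_⟩
  funext ⟨⟨i, j, k⟩, hij, hjk⟩
  obtain ⟨rfl, ⟨rfl, rfl⟩ | ⟨rfl, rfl⟩ | ⟨rfl, rfl⟩ | ⟨rfl, rfl⟩ | ⟨rfl, rfl⟩ | ⟨rfl, rfl⟩⟩ :=
    S2.strict_chain_cases i j k hij hjk
  · change b ⟨(e₀₁, top), _⟩ - b ⟨(v₀, top), _⟩ + p e₀₁ top _ (b ⟨(v₀, e₀₁), _⟩) = _
    rw [hx₀₁, hy₀, h₀₁, map_zero, sub_zero, add_zero]
  · change b ⟨(e₀₁, top), _⟩ - b ⟨(v₁, top), _⟩ + p e₀₁ top _ (b ⟨(v₁, e₀₁), _⟩) = _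
    rw [hx₀₁, hy₁, h₁₁, map_zero, add_zero]
    exact sub_sub_cancel _ _
  · change b ⟨(e₁₂, top), _⟩ - b ⟨(v₁, top), _⟩ + p e₁₂ top _ (b ⟨(v₁, e₁₂), _⟩) = _
    rw [hx₁₂, hy₁, h₁₂, map_zero, add_zero]
    exact add_sub_cancel_left _ _
  · change b ⟨(e₁₂, top), _⟩ - b ⟨(v₂, top), _⟩ + p e₁₂ top _ (b ⟨(v₂, e₁₂), _⟩) = _
    rw [hx₁₂, hy₂, h₂₁, map_zero, add_zero]
    exact sub_sub_cancel _ _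
  · change b ⟨(e₀₂, top), _⟩ - b ⟨(v₂, top), _⟩ + p e₀₂ top _ (b ⟨(v₂, e₀₂), _⟩) = _
    rw [hx₀₂, hy₂, h₂₂, map_zero, add_zero]
    exact add_sub_cancel_left _ _
  · change b ⟨(e₀₂, top), _⟩ - b ⟨(v₀, top), _⟩ + p e₀₂ top _ (b ⟨(v₀, e₀₂), _⟩) = _
    rw [hx₀₂, hy₀, hz₀, sub_zero]
    exact (congrArg (x₀₂ + ·) hz).trans (add_sub_cancel _ _)
end

section
/- In the ring A ⊗_ℚ A, where A = ℚ[x₁,x₂,x₃]/(σ₁,σ₂,σ₃), the identity 2·ρ(x₁ ⊗ x₂)² = −ρ(x₁x₂ ⊗ x₂x₃) holds. -/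
set_option maxHeartbeats 1000000
set_option synthInstance.maxHeartbeats 400000

open MvPolynomial TensorProduct

/-- The ideal `(σ₁, σ₂, σ₃)` of elementary symmetric polynomials. -/
noncomputable abbrev symIdeal : Ideal (MvPolynomial (Fin 3) ℚ) :=
  Ideal.span {esymm (Fin 3) ℚ 1, esymm (Fin 3) ℚ 2, esymm (Fin 3) ℚ 3}

/-- `A = ℚ[x₁,x₂,x₃]/(σ₁,σ₂,σ₃)`, the rational cohomology ring of `Fl₃(ℂ)`. -/
noncomputable abbrev FlagRing := MvPolynomial (Fin 3) ℚ ⧸ symIdeal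

/-- The generators `x₁, x₂, x₃` of `A` (indexed by `Fin 3`). -/
noncomputable def xx (i : Fin 3) : FlagRing := Ideal.Quotient.mk symIdeal (X i)

lemma rename_mem_symIdeal (g : Equiv.Perm (Fin 3)) {a : MvPolynomial (Fin 3) ℚ}
    (ha : a ∈ symIdeal) : rename (⇑g) a ∈ symIdeal := by
  have h : symIdeal.map (rename (⇑g)).toRingHom ≤ symIdeal := by
    rw [Ideal.map_span]
    refine Ideal.span_le.2 ?_
    rintro x ⟨y, hy, rfl⟩
    simp only [Set.mem_insert_iff, Set.mem_singleton_iff] at hy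
    rcases hy with rfl | rfl | rfl <;>
      · show (rename (⇑g)) _ ∈ _
        rw [rename_esymm]
        apply Ideal.subset_span
        simp
  exact h (Ideal.mem_map_of_mem _ ha)

/-- The action of `ω ∈ Σ₃` on `A` by permuting the variables. -/
noncomputable def permAct (g : Equiv.Perm (Fin 3)) : FlagRing →ₐ[ℚ] FlagRing :=
  Ideal.Quotient.liftₐ symIdeal
    ((Ideal.Quotient.mkₐ ℚ symIdeal).comp (rename (⇑g)))
    (fun a ha => by
      show Ideal.Quotient.mkₐ ℚ symIdeal (rename (⇑g) a) = 0
      rw [Ideal.Quotient.mkₐ_eq_mk]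
      exact Ideal.Quotient.eq_zero_iff_mem.2 (rename_mem_symIdeal g ha))

/-- The diagonal action of `ω ∈ Σ₃` on `A ⊗_ℚ A`. -/
noncomputable def permActT (g : Equiv.Perm (Fin 3)) :
    FlagRing ⊗[ℚ] FlagRing →ₐ[ℚ] FlagRing ⊗[ℚ] FlagRing :=
  Algebra.TensorProduct.map (permAct g) (permAct g)

/-- The averaging operator `ρ(f) = (1/6) ∑_{ω ∈ Σ₃} ω·f` on `A ⊗_ℚ A`. -/
noncomputable def avg (f : FlagRing ⊗[ℚ] FlagRing) : FlagRing ⊗[ℚ] FlagRing :=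
  (6 : ℚ)⁻¹ • ∑ g : Equiv.Perm (Fin 3), permActT g f

lemma xx_sum : xx 0 + xx 1 + xx 2 = 0 := by
  have h : esymm (Fin 3) ℚ 1 ∈ symIdeal := Ideal.subset_span (by simp)
  have h' := Ideal.Quotient.eq_zero_iff_mem.2 h
  simpa [esymm_one, Fin.sum_univ_three, xx] using h'

lemma esymm_fin_three_two :
    esymm (Fin 3) ℚ 2 = X 0 * X 1 + X 0 * X 2 + X 1 * X 2 := by
  have h : Finset.powersetCard 2 (Finset.univ : Finset (Fin 3)) = {{0, 1}, {0, 2}, {1, 2}} := by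
    decide
  rw [esymm, h, Finset.sum_insert (by decide), Finset.sum_insert (by decide),
    Finset.sum_singleton, Finset.prod_pair (by decide), Finset.prod_pair (by decide),
    Finset.prod_pair (by decide), add_assoc]

lemma xx_sum_mul : xx 0 * xx 1 + xx 0 * xx 2 + xx 1 * xx 2 = 0 := by
  have h : esymm (Fin 3) ℚ 2 ∈ symIdeal := Ideal.subset_span (by simp)
  have h' := Ideal.Quotient.eq_zero_iff_mem.2 h
  simpa [esymm_fin_three_two, xx] using h'

lemma permAct_xx (g : Equiv.Perm (Fin 3)) (i : Fin 3) : permAct g (xx i) = xx (g i) := by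
  change Ideal.Quotient.mk symIdeal (rename (⇑g) (X i)) = _
  rw [rename_X, xx]

lemma sum_perm_fin_three {M : Type*} [AddCommMonoid M] (f : Fin 3 → Fin 3 → Fin 3 → M) :
    ∑ g : Equiv.Perm (Fin 3), f (g 0) (g 1) (g 2) =
      f 0 1 2 + f 0 2 1 + f 1 0 2 + f 1 2 0 + f 2 0 1 + f 2 1 0 := by
  have h : (Finset.univ : Finset (Equiv.Perm (Fin 3))) =
      {1, Equiv.swap 1 2, Equiv.swap 0 1, Equiv.swap 0 1 * Equiv.swap 1 2,
        Equiv.swap 0 2 * Equiv.swap 1 2, Equiv.swap 0 2} := by decide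
  rw [h]
  repeat rw [Finset.sum_insert (by decide)]
  rw [Finset.sum_singleton]
  simp only [add_assoc]
  rfl

/-- The identity behind `two_avg_sq_eq_neg_avg`, for two triples with vanishing first and second
elementary symmetric functions. -/
lemma sq_sum_mul_eq_neg_three_mul {R : Type*} [CommRing R] {a b c x y z : R}
    (h₁ : a + b + c = 0) (h₂ : a * b + a * c + b * c = 0)
    (k₁ : x + y + z = 0) (k₂ : x * y + x * z + y * z = 0) :
    (a * y + a * z + b * x + b * z + c * x + c * y) ^ 2 =
      -3 * (a * b * (y * z) + a * c * (z * y) + b * a * (x * z) + b * c * (z * x) +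
        c * a * (x * y) + c * b * (y * x)) := by
  obtain rfl : c = -a - b := by linear_combination h₁
  obtain rfl : z = -x - y := by linear_combination k₁
  have h : b ^ 2 = -a ^ 2 - a * b := by linear_combination -h₂
  have k : y ^ 2 = -x ^ 2 - x * y := by linear_combination -k₂
  grind

lemma two_mul_smul_sq_of_sq_eq {R : Type*} [CommRing R] [Algebra ℚ R] {s t : R}
    (h : s ^ 2 = -3 * t) : 2 * ((6 : ℚ)⁻¹ • s) ^ 2 = -((6 : ℚ)⁻¹ • t) := by
  have h6 : (6 : R) * algebraMap ℚ R 6⁻¹ = 1 := by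
    rw [← map_ofNat (algebraMap ℚ R) 6, ← map_mul]
    norm_num
  simp only [Algebra.smul_def]
  linear_combination 2 * algebraMap ℚ R 6⁻¹ ^ 2 * h - algebraMap ℚ R 6⁻¹ * t * h6

/-- In `A ⊗_ℚ A`, `2·ρ(x₁ ⊗ x₂)² = −ρ(x₁x₂ ⊗ x₂x₃)`. -/
theorem two_avg_sq_eq_neg_avg :
    (2 : FlagRing ⊗[ℚ] FlagRing) * (avg (xx 0 ⊗ₜ[ℚ] xx 1)) ^ 2 =
      - avg ((xx 0 * xx 1) ⊗ₜ[ℚ] (xx 1 * xx 2)) := by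
  let l : FlagRing →ₐ[ℚ] FlagRing ⊗[ℚ] FlagRing := Algebra.TensorProduct.includeLeft
  let r : FlagRing →ₐ[ℚ] FlagRing ⊗[ℚ] FlagRing := Algebra.TensorProduct.includeRight
  have tmul_eq (x y : FlagRing) : x ⊗ₜ[ℚ] y = l x * r y := by simp [l, r]
  have key := sq_sum_mul_eq_neg_three_mul (a := l (xx 0)) (b := l (xx 1)) (c := l (xx 2))
    (x := r (xx 0)) (y := r (xx 1)) (z := r (xx 2))
    (by simpa using congrArg l xx_sum) (by simpa using congrArg l xx_sum_mul)
    (by simpa using congrArg r xx_sum) (by simpa using congrArg r xx_sum_mul)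
  simp only [avg, permActT, Algebra.TensorProduct.map_tmul, map_mul, permAct_xx]
  simp only [tmul_eq, map_mul]
  rw [sum_perm_fin_three fun i j _ => l (xx i) * r (xx j),
    sum_perm_fin_three fun i j k => l (xx i) * l (xx j) * (r (xx j) * r (xx k))]
  exact two_mul_smul_sq_of_sq_eq key
end
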